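/- arXiv:1310.2447 — 2 statements merged into one kernel-verified Lean document; each statement's English description precedes it below -/
import Mathlib

section
/- Let g ∈ ℂ[X,Y] be an irreducible bivariate polynomial of total degree d ≥ 1. Then either g is of the form aY + b for some constants a, b ∈ ℂ, or the set of solutions in ℂ² of the system g(X,Y) = 0, ∂g/∂X(X,Y) = 0 is finite with at most d(d−1) elements. -/
open MvPolynomial

theorem two_mul_finrank_restrictTotalDegree_fin_two (K : Type*) [Field K] (m : ℕ) :
    2 * Module.finrank K (restrictTotalDegree (Fin 2) K m) = (m + 1) * (m + 2) := by
  have hcard : Nat.card {n : Fin 2 →₀ ℕ | n.degree ≤ m} = ∑ j ∈ Finset.range (m + 1), (j + 1) := by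
    have hset : {n : Fin 2 →₀ ℕ | n.degree ≤ m} = ((Finset.range (m + 1)).biUnion
        fun j ↦ Finset.finsuppAntidiag (Finset.univ : Finset (Fin 2)) j :
          Finset (Fin 2 →₀ ℕ)) := by
      ext n
      simp [Finset.mem_finsuppAntidiag, Finsupp.degree_eq_sum]
    rw [hset, Nat.card_coe_set_eq, Set.ncard_coe_finset, Finset.card_biUnion]
    · refine Finset.sum_congr rfl fun j _ ↦ ?_
      simp [Finset.card_finsuppAntidiag_nat_eq_choose, add_comm]
    · intro i _ j _ hij
      refine Finset.disjoint_left.2 fun n hi hj ↦ hij ?_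
      rw [Finset.mem_finsuppAntidiag] at hi hj
      exact hi.1.symm.trans hj.1
  have hfin : Module.finrank K (restrictTotalDegree (Fin 2) K m) = _ :=
    Module.finrank_eq_nat_card_basis (basisRestrictSupport K {n : Fin 2 →₀ ℕ | n.degree ≤ m})
  rw [hfin, hcard, Finset.sum_add_distrib, mul_add, mul_comm 2, Finset.sum_range_id_mul_two]
  simp
  ring

theorem exists_eval_ne_zero_of_forall_mem_eval_eq_zero {σ K : Type*} [Field K]
    (s : Finset (σ → K)) (p : σ → K) (hp : p ∉ s) :
    ∃ L : MvPolynomial σ K, eval p L ≠ 0 ∧ ∀ q ∈ s, eval q L = 0 := by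
  have h : ∀ q : σ → K, q ≠ p → ∃ l : MvPolynomial σ K, eval p l ≠ 0 ∧ eval q l = 0 := by
    intro q hq
    obtain ⟨i, hi⟩ := Function.ne_iff.1 hq
    exact ⟨X i - C (q i), by simpa [sub_eq_zero] using hi.symm, by simp⟩
  choose! l hlp hlq using h
  refine ⟨∏ q ∈ s, l q, ?_, fun q hq ↦ ?_⟩
  · rw [map_prod, Finset.prod_ne_zero_iff]
    exact fun q hq ↦ hlp q (ne_of_mem_of_not_mem hq hp)
  · rw [map_prod]
    exact Finset.prod_eq_zero hq (hlq q (ne_of_mem_of_not_mem hq hp))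

theorem finset_card_le_totalDegree_mul_totalDegree {K : Type*} [Field K]
    (f g : MvPolynomial (Fin 2) K) (hf : Irreducible f) (hfg : ¬ f ∣ g) (s : Finset (Fin 2 → K))
    (hs : ∀ p ∈ s, eval p f = 0 ∧ eval p g = 0) :
    s.card ≤ f.totalDegree * g.totalDegree := by
  classical
  have hg0 : g ≠ 0 := by rintro rfl; exact hfg (dvd_zero f)
  choose! L hL0 hL using fun p (hp : p ∈ s) ↦
    exists_eval_ne_zero_of_forall_mem_eval_eq_zero (s.erase p) p (by simp)
  set m := f.totalDegree
  set n := g.totalDegree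
  set t := s.sup fun p ↦ (L p).totalDegree
  let V := fun k ↦ restrictTotalDegree (Fin 2) K k
  have hmul : ∀ (a b : MvPolynomial (Fin 2) K) (i j k : ℕ), a.totalDegree ≤ i → b ∈ V j →
      i + j ≤ k → a * b ∈ V k := fun a b i j k ha hb hk ↦ by
    rw [mem_restrictTotalDegree] at hb ⊢
    exact (totalDegree_mul a b).trans (by omega)
  let E : V (m + n + t) →ₗ[K] (s → K) :=
    (LinearMap.pi fun p : s ↦ (aeval (R := K) p.1).toLinearMap) ∘ₗ (V (m + n + t)).subtype
  have hE : ∀ x p, E x p = eval p.1 x.1 := fun x p ↦ by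
    simp [E, aeval_eq_eval]
  have hEsurj : Function.Surjective E := by
    intro v
    have hLV : ∀ p : s, L p.1 ∈ V (m + n + t) := fun p ↦
      (mem_restrictTotalDegree _ _ _).2 <|
        (Finset.le_sup (f := fun p ↦ (L p).totalDegree) p.2).trans (Nat.le_add_left _ _)
    refine ⟨∑ p : s, (v p / eval p.1 (L p.1)) • ⟨L p.1, hLV p⟩, ?_⟩
    ext q
    rw [map_sum, Finset.sum_apply, Finset.sum_eq_single q]
    · rw [map_smul, Pi.smul_apply, hE]
      simp [hL0 q.1 q.2]
    · intro p _ hpq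
      rw [map_smul, Pi.smul_apply, hE]
      simp [hL p.1 p.2 q.1 (Finset.mem_erase.2 ⟨fun h ↦ hpq (Subtype.ext h.symm), q.2⟩)]
    · simp
  let A : V (n + t) →ₗ[K] V (m + n + t) :=
    (LinearMap.mulLeft K f).restrict fun x hx ↦ hmul f x m _ _ le_rfl hx (by omega)
  let B : V (m + t) →ₗ[K] V (m + n + t) :=
    (LinearMap.mulLeft K g).restrict fun x hx ↦ hmul g x n _ _ le_rfl hx (by omega)
  let Φ := A.coprod B
  have hΦ : ∀ x, (Φ x).1 = f * x.1.1 + g * x.2.1 := fun x ↦ rfl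
  have hrange : LinearMap.range Φ ≤ LinearMap.ker E := by
    rintro _ ⟨x, rfl⟩
    rw [LinearMap.mem_ker]
    ext p
    rw [hE, hΦ]
    simp [hs p.1 p.2]
  let A' : V t →ₗ[K] V (n + t) :=
    (LinearMap.mulLeft K g).restrict fun x hx ↦ hmul g x n _ _ le_rfl hx (by omega)
  let B' : V t →ₗ[K] V (m + t) :=
    (LinearMap.mulLeft K (-f)).restrict fun x hx ↦
      hmul (-f) x m _ _ (totalDegree_neg f).le hx (by omega)
  have hker : LinearMap.ker Φ ≤ LinearMap.range (A'.prod B') := by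
    rintro ⟨⟨a, ha⟩, ⟨b, hb⟩⟩ hab
    have hab : f * a + g * b = 0 := congrArg Subtype.val (LinearMap.mem_ker.1 hab)
    have hdvd : f ∣ b := (hf.prime.dvd_or_dvd ((Dvd.intro (-a) (by linear_combination -hab)) :
      f ∣ g * b)).resolve_left hfg
    obtain ⟨c, rfl⟩ := hdvd
    have ha' : a = g * -c := mul_left_cancel₀ hf.ne_zero (by linear_combination hab)
    have hc : -c ∈ V t := by
      rw [mem_restrictTotalDegree] at ha ⊢
      by_cases h0 : -c = 0
      · simp [h0]
      · rw [ha', totalDegree_mul_of_isDomain hg0 h0] at ha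
        omega
    refine ⟨⟨-c, hc⟩, ?_⟩
    ext1
    · exact Subtype.ext ha'.symm
    · exact Subtype.ext (show -f * -c = f * c by ring)
  have h1 := LinearMap.finrank_range_add_finrank_ker E
  have h2 := LinearMap.finrank_range_add_finrank_ker Φ
  have h3 := Submodule.finrank_mono hrange
  have h4 := (Submodule.finrank_mono hker).trans (LinearMap.finrank_range_le _)
  rw [LinearMap.range_eq_top.2 hEsurj, finrank_top, Module.finrank_fintype_fun_eq_card,
    Fintype.card_coe] at h1
  rw [Module.finrank_prod] at h2
  have d1 := two_mul_finrank_restrictTotalDegree_fin_two K (m + n + t)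
  have d2 := two_mul_finrank_restrictTotalDegree_fin_two K (n + t)
  have d3 := two_mul_finrank_restrictTotalDegree_fin_two K (m + t)
  have d4 := two_mul_finrank_restrictTotalDegree_fin_two K t
  simp only [V] at h1 h2 h3 h4
  nlinarith

theorem totalDegree_pderiv_le {σ R : Type*} [CommSemiring R] (i : σ) (p : MvPolynomial σ R) :
    (pderiv i p).totalDegree ≤ p.totalDegree - 1 := by
  refine Finset.sup_le fun m hm ↦ ?_
  rw [mem_support_iff, coeff_pderiv] at hm
  have h := le_totalDegree (mem_support_iff.2 (left_ne_zero_of_mul hm))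
  change (m + Finsupp.single i 1).degree ≤ _ at h
  rw [map_add, Finsupp.degree_single] at h
  exact Nat.le_sub_of_add_le h

theorem notMem_vars_of_pderiv_eq_zero {σ R : Type*} [CommRing R] [IsDomain R] [CharZero R]
    {i : σ} {p : MvPolynomial σ R} (h : pderiv i p = 0) : i ∉ p.vars := by
  intro hi
  obtain ⟨d, hd, hid⟩ := (mem_vars_iff_mem_support i).1 hi
  have hc := congrArg (coeff (d - Finsupp.single i 1)) h
  have hle : Finsupp.single i 1 ≤ d := by
    rw [Finsupp.single_le_iff]
    exact Nat.one_le_iff_ne_zero.2 (Finsupp.mem_support_iff.1 hid)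
  rw [coeff_pderiv, tsub_add_cancel_of_le hle, coeff_zero] at hc
  refine (mul_ne_zero (mem_support_iff.1 hd) ?_) hc
  exact Nat.cast_add_one_ne_zero _

theorem Irreducible.exists_eq_linear_of_pderiv_zero_eq_zero {K : Type*} [Field K] [CharZero K]
    [IsAlgClosed K] {g : MvPolynomial (Fin 2) K} (hg : Irreducible g)
    (h : pderiv 0 g = 0) : ∃ a b : K, g = C a * X 1 + C b := by
  obtain ⟨q, rfl⟩ := exists_rename_eq_of_vars_subset_range g (fun _ : Unit ↦ (1 : Fin 2))
    (fun _ _ _ ↦ rfl) (by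
      intro i hi
      fin_cases i
      · exact absurd hi (notMem_vars_of_pderiv_eq_zero h)
      · exact ⟨(), rfl⟩)
  obtain ⟨p, rfl⟩ := (uniqueAlgEquiv K Unit).symm.surjective q
  let φ : Polynomial K →ₐ[K] MvPolynomial (Fin 2) K := Polynomial.aeval (X 1)
  have hφ : rename (fun _ : Unit ↦ (1 : Fin 2)) ((uniqueAlgEquiv K Unit).symm p) = φ p := by
    refine DFunLike.congr_fun (f := (rename _).comp (uniqueAlgEquiv K Unit).symm.toAlgHom)
      (g := φ) ?_ p
    ext1
    simp [φ]
  have hψ : ∀ r, aeval (fun _ ↦ Polynomial.X) (φ r) = r := by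
    refine DFunLike.congr_fun (f := (aeval fun _ ↦ Polynomial.X).comp φ)
      (g := AlgHom.id K (Polynomial K)) ?_
    ext1
    simp [φ]
  rw [hφ] at hg ⊢
  have : IsLocalHom φ := ⟨fun r hr ↦ by
    simpa only [hψ] using hr.map (aeval fun _ ↦ (Polynomial.X : Polynomial K))⟩
  have hp : Irreducible p := hg.of_map
  refine ⟨p.coeff 1, p.coeff 0, ?_⟩
  conv_lhs => rw [Polynomial.eq_X_add_C_of_degree_le_one
    (IsAlgClosed.degree_eq_one_of_irreducible K hp).le]
  simp [φ, algebraMap_eq]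

/-- **Lemma 6.** If `g ∈ ℂ[X,Y]` is irreducible of total degree `d ≥ 1`, then either
`g` is of the form `aY + b`, or the system `g = ∂g/∂X = 0` has at most `d(d-1)`
solutions in `ℂ²`. -/
theorem irreducible_linear_or_finite_common_zeros_with_pderivX
    (g : MvPolynomial (Fin 2) ℂ) (hirr : Irreducible g)
    (d : ℕ) (hd : g.totalDegree = d) (hd1 : 1 ≤ d) :
    (∃ a b : ℂ, g = C a * X 1 + C b) ∨
      ({p : ℂ × ℂ | eval ![p.1, p.2] g = 0 ∧
          eval ![p.1, p.2] (pderiv (0 : Fin 2) g) = 0}.Finite ∧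
        {p : ℂ × ℂ | eval ![p.1, p.2] g = 0 ∧
          eval ![p.1, p.2] (pderiv (0 : Fin 2) g) = 0}.ncard ≤ d * (d - 1)) := by
  by_cases h0 : pderiv (0 : Fin 2) g = 0
  · exact Or.inl (hirr.exists_eq_linear_of_pderiv_zero_eq_zero h0)
  right
  subst hd
  have hdeg := totalDegree_pderiv_le (0 : Fin 2) g
  have hdvd : ¬ g ∣ pderiv 0 g := fun h ↦ by
    have := totalDegree_le_of_dvd_of_isDomain h h0
    omega
  set S := {p : ℂ × ℂ | eval ![p.1, p.2] g = 0 ∧ eval ![p.1, p.2] (pderiv (0 : Fin 2) g) = 0}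
  have hcard : ∀ s : Finset (ℂ × ℂ), ↑s ⊆ S → s.card ≤ g.totalDegree * (g.totalDegree - 1) := by
    intro s hs
    rw [← Finset.card_map (finTwoArrowEquiv ℂ).symm.toEmbedding]
    refine (finset_card_le_totalDegree_mul_totalDegree g (pderiv 0 g) hirr hdvd _
      fun p hp ↦ ?_).trans
      (Nat.mul_le_mul_left _ hdeg)
    obtain ⟨q, hq, rfl⟩ := Finset.mem_map.1 hp
    exact hs hq
  have hfin : S.Finite := by
    by_contra hinf
    obtain ⟨s, hs, hsc⟩ := Set.Infinite.exists_subset_card_eq hinf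
      (g.totalDegree * (g.totalDegree - 1) + 1)
    have := hcard s hs
    omega
  refine ⟨hfin, ?_⟩
  rw [Set.ncard_eq_toFinset_card S hfin]
  exact hcard _ (by simp)
end

section
/- Let g ∈ ℝ[X,Y] be a nonzero bivariate polynomial of total degree d, and let 𝒰 be an open subset of ℝ². Then the set {(x,y) ∈ 𝒰 : g(x,y) = 0} is either infinite or has at most d² elements. -/
open MvPolynomial

namespace MvPolynomial

open Module

section Bezout

variable {K : Type*} [Field K]

theorem two_mul_finrank_restrictTotalDegree_fin_two (k : ℕ) :
    2 * finrank K (restrictTotalDegree (Fin 2) K k) = (k + 1) * (k + 2) := by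
  rw [restrictTotalDegree, finrank_eq_nat_card_basis (basisRestrictSupport K _)]
  have e : {n : Fin 2 →₀ ℕ | (n.sum fun _ e => e) ≤ k} ≃
      (Finset.range (k + 1)).sigma fun i => Finset.HasAntidiagonal.antidiagonal i :=
    { toFun := fun n => ⟨⟨n.1 0 + n.1 1, (n.1 0, n.1 1)⟩, by
        have := n.2
        simp only [Set.mem_ofPred_eq, Finsupp.sum_fintype, implies_true, Fin.sum_univ_two] at this
        simp
        omega⟩
      invFun := fun p => ⟨Finsupp.equivFunOnFinite.symm ![p.1.2.1, p.1.2.2], by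
        have := p.2
        simp only [Finset.mem_sigma, Finset.mem_range, Finset.HasAntidiagonal.mem_antidiagonal] at this
        simp [Finsupp.sum_fintype, Fin.sum_univ_two]
        omega⟩
      left_inv := fun n => by
        ext i
        fin_cases i <;> simp
      right_inv := fun p => by
        obtain ⟨⟨i, a, b⟩, hp⟩ := p
        simp only [Finset.mem_sigma, Finset.mem_range, Finset.HasAntidiagonal.mem_antidiagonal] at hp
        obtain ⟨-, rfl⟩ := hp
        simp }
  rw [Nat.card_congr e, Nat.card_eq_fintype_card, Fintype.card_coe, Finset.card_sigma]
  simp only [Finset.Nat.card_antidiagonal]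
  have := Finset.sum_range_id_mul_two (k + 2)
  rw [Finset.sum_range_succ'] at this
  simp only [add_zero] at this
  rw [mul_comm, this]
  simp [mul_comm]

/-- A polynomial of degree at most `#S` separating `p` from the rest of `S`. -/
theorem exists_totalDegree_le_card_eval_ne_zero {σ : Type*} (S : Finset (σ → K)) (p : σ → K) :
    ∃ q : MvPolynomial σ K, q.totalDegree ≤ S.card ∧ eval p q ≠ 0 ∧
      ∀ s ∈ S, s ≠ p → eval s q = 0 := by
  classical
  induction S using Finset.induction_on with
  | empty => exact ⟨1, by simp⟩
  | insert a S ha ih =>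
    obtain ⟨q, hq, hp, hS⟩ := ih
    rw [Finset.card_insert_of_notMem ha]
    by_cases hap : a = p
    · refine ⟨q, by omega, hp, fun s hs hsp => hS s ?_ hsp⟩
      exact Finset.mem_of_mem_insert_of_ne hs (hap ▸ hsp)
    · obtain ⟨i, hi⟩ := Function.ne_iff.mp hap
      refine ⟨q * (X i - C (a i)), ?_, ?_, ?_⟩
      · have h₁ := totalDegree_mul q (X i - C (a i))
        have h₂ := totalDegree_sub_C_le (X i : MvPolynomial σ K) (a i)
        rw [totalDegree_X] at h₂
        omega
      · simpa [hp, sub_eq_zero] using Ne.symm hi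
      · intro s hs hsp
        rcases Finset.mem_insert.mp hs with rfl | hs
        · simp
        · simp [hS s hs hsp]

/-- The restriction of evaluation at the points of `S` to polynomials of bounded degree. -/
noncomputable def evalOn {σ : Type*} (S : Finset (σ → K)) (k : ℕ) :
    restrictTotalDegree σ K k →ₗ[K] S → K :=
  LinearMap.pi fun s => (aeval s.1).toLinearMap ∘ₗ Submodule.subtype _

theorem evalOn_apply {σ : Type*} (S : Finset (σ → K)) (k : ℕ)
    (q : restrictTotalDegree σ K k) (s : S) : evalOn S k q s = eval s.1 q.1 := by
  simp [evalOn, aeval_eq_eval]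

theorem evalOn_surjective {σ : Type*} (S : Finset (σ → K)) {k : ℕ} (hk : S.card ≤ k) :
    Function.Surjective (evalOn S k) := by
  classical
  rw [← LinearMap.range_eq_top, eq_top_iff, ← (Pi.basisFun K S).span_eq, Submodule.span_le]
  rintro _ ⟨p, rfl⟩
  obtain ⟨q, hq, hp, hS⟩ := exists_totalDegree_le_card_eval_ne_zero S p.1
  have hmem : q ∈ restrictTotalDegree σ K k := (mem_restrictTotalDegree _ _ _).mpr (hq.trans hk)
  refine ⟨(eval p.1 q)⁻¹ • ⟨q, hmem⟩, ?_⟩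
  ext s
  rw [map_smul, Pi.smul_apply, evalOn_apply, Pi.basisFun_apply]
  by_cases h : s = p
  · subst h
    simp [hp]
  · simp [h, hS s s.2 (fun h' => h (Subtype.ext h'))]

/-- The weak form of Bézout's theorem for affine plane curves. -/
theorem card_common_zeros_le {f h : MvPolynomial (Fin 2) K} (hf : f ≠ 0)
    (hfh : IsRelPrime f h) (S : Finset (Fin 2 → K))
    (hSf : ∀ s ∈ S, eval s f = 0) (hSh : ∀ s ∈ S, eval s h = 0) :
    S.card ≤ f.totalDegree * h.totalDegree := by
  set m := f.totalDegree with hm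
  set n := h.totalDegree with hn
  set r := S.card with hr
  let P := restrictTotalDegree (Fin 2) K
  let φ : P (n + r) × P (m + r) →ₗ[K] MvPolynomial (Fin 2) K :=
    LinearMap.coprod (LinearMap.mulRight K f ∘ₗ Submodule.subtype _)
      (LinearMap.mulRight K h ∘ₗ Submodule.subtype _)
  have hφ (a) : φ a = a.1.1 * f + a.2.1 * h := by simp [φ]
  have hmem {k : ℕ} {q : MvPolynomial (Fin 2) K} : q ∈ P k ↔ q.totalDegree ≤ k :=
    mem_restrictTotalDegree _ _ _
  -- The syzygies of `(f, h)` are the multiples of `(-h, f)`.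
  have hker : finrank K (LinearMap.ker φ) ≤ finrank K (P r) := by
    let ψ : P r →ₗ[K] P (n + r) × P (m + r) :=
      LinearMap.prod
        ((-(LinearMap.mulRight K h ∘ₗ Submodule.subtype _)).codRestrict _ fun c => by
          rw [hmem]
          have h₁ := totalDegree_mul c.1 h
          have h₂ := hmem.mp c.2
          simp
          omega)
        ((LinearMap.mulRight K f ∘ₗ Submodule.subtype _).codRestrict _ fun c => by
          rw [hmem]
          have h₁ := totalDegree_mul c.1 f
          have h₂ := hmem.mp c.2
          simp
          omega)
    refine (Submodule.finrank_mono (t := LinearMap.range ψ) ?_).trans (LinearMap.finrank_range_le ψ)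
    rintro ⟨⟨a, ha⟩, ⟨b, hb⟩⟩ hab
    rw [LinearMap.mem_ker, hφ] at hab
    simp only at hab
    obtain ⟨c, rfl⟩ : f ∣ b := by
      refine hfh.dvd_of_dvd_mul_right ⟨-a, ?_⟩
      linear_combination hab
    have hac : a = -(c * h) := by
      refine mul_right_cancel₀ hf ?_
      linear_combination hab
    have hc : c ∈ P r := by
      rw [hmem] at hb ⊢
      rcases eq_or_ne c 0 with rfl | hc
      · simp
      · rw [totalDegree_mul_of_isDomain hf hc] at hb
        omega
    refine ⟨⟨c, hc⟩, ?_⟩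
    ext1 <;> ext1
    · simp [ψ, hac]
    · simp [ψ, mul_comm]
  have hrange : LinearMap.range φ ≤
      (LinearMap.ker (evalOn S (m + n + r))).map (Submodule.subtype _) := by
    rintro _ ⟨⟨⟨a, ha⟩, ⟨b, hb⟩⟩, rfl⟩
    rw [hφ]
    simp only
    rw [hmem] at ha hb
    have hle : (a * f + b * h).totalDegree ≤ m + n + r := by
      refine (totalDegree_add _ _).trans (max_le ?_ ?_)
      · exact (totalDegree_mul _ _).trans (by omega)
      · exact (totalDegree_mul _ _).trans (by omega)
    refine ⟨⟨_, hmem.mpr hle⟩, ?_, rfl⟩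
    rw [SetLike.mem_coe, LinearMap.mem_ker]
    ext s
    rw [evalOn_apply]
    simp [hSf s s.2, hSh s s.2]
  have hrange' := Submodule.finrank_mono hrange
  rw [Submodule.finrank_map_subtype_eq] at hrange'
  have hφ_rank := LinearMap.finrank_range_add_finrank_ker φ
  have hev_rank := LinearMap.finrank_range_add_finrank_ker (evalOn S (m + n + r))
  rw [LinearMap.range_eq_top.mpr (evalOn_surjective S (by omega)), finrank_top,
    finrank_fintype_fun_eq_card, Fintype.card_coe] at hev_rank
  rw [finrank_prod] at hφ_rank
  have h₁ := two_mul_finrank_restrictTotalDegree_fin_two (K := K) (m + n + r)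
  have h₂ := two_mul_finrank_restrictTotalDegree_fin_two (K := K) (n + r)
  have h₃ := two_mul_finrank_restrictTotalDegree_fin_two (K := K) (m + r)
  have h₄ := two_mul_finrank_restrictTotalDegree_fin_two (K := K) r
  simp only [P] at *
  nlinarith

end Bezout

section PDeriv

variable {σ R : Type*} [CommSemiring R]

theorem totalDegree_pderiv_le (i : σ) (g : MvPolynomial σ R) :
    (pderiv i g).totalDegree ≤ g.totalDegree - 1 := by
  refine Finset.sup_le fun m hm => ?_
  rw [mem_support_iff, coeff_pderiv] at hm
  have := le_totalDegree (mem_support_iff.mpr (left_ne_zero_of_mul hm))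
  rw [Finsupp.sum_add_index' (fun _ => rfl) (fun _ _ _ => rfl),
    Finsupp.sum_single_index rfl] at this
  omega

theorem exists_pderiv_ne_zero [NoZeroDivisors R] [CharZero R] {g : MvPolynomial σ R}
    (hg : g.totalDegree ≠ 0) : ∃ i, pderiv i g ≠ 0 := by
  contrapose! hg
  refine Nat.eq_zero_of_le_zero (Finset.sup_le fun m hm => ?_)
  have hm0 : m = 0 := by
    by_contra h
    obtain ⟨i, hi⟩ := Finsupp.ne_iff.mp h
    have := coeff_pderiv (i := i) g (m - Finsupp.single i 1)
    rw [hg i, coeff_zero, tsub_add_cancel_of_le (by simpa [Nat.one_le_iff_ne_zero] using hi),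
      eq_comm, mul_eq_zero] at this
    rcases this with h | h
    · exact mem_support_iff.mp hm h
    · exact Nat.cast_add_one_ne_zero _ h
  simp [hm0]

theorem hasDerivAt_eval_update [DecidableEq σ] (g : MvPolynomial σ ℝ) (p : σ → ℝ) (i : σ) :
    HasDerivAt (fun t => eval (Function.update p i t) g) (eval p (pderiv i g)) (p i) := by
  induction g using MvPolynomial.induction_on with
  | C a => simpa using hasDerivAt_const (p i) a
  | add f g hf hg => simpa using! hf.add hg
  | mul_X f j hf =>
    have hX : HasDerivAt (fun t => Function.update p i t j) (eval p (pderiv i (X j))) (p i) := by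
      rcases eq_or_ne j i with rfl | h
      · simpa using! hasDerivAt_id (p j)
      · simpa [h, pderiv_X_of_ne h] using hasDerivAt_const (p i) (p j)
    simpa [pderiv_mul, mul_comm, add_comm] using! hf.mul hX

end PDeriv

end MvPolynomial

theorem isConnected_ball_diff_center {E : Type*} [NormedAddCommGroup E] [NormedSpace ℝ E]
    (h : 1 < Module.rank ℝ E) (p : E) {r : ℝ} (hr : 0 < r) :
    IsConnected (Metric.ball p r \ {p}) := by
  let e := OpenPartialHomeomorph.univBall p r
  have himage : e '' {0}ᶜ = Metric.ball p r \ {p} := by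
    have hinj : Function.Injective e := fun a b hab =>
      e.injOn (by simp [e]) (by simp [e]) hab
    rw [Set.compl_eq_univ_sdiff, Set.image_sdiff hinj, Set.image_singleton,
      ← OpenPartialHomeomorph.univBall_source p r, e.image_source_eq_target,
      OpenPartialHomeomorph.univBall_target p hr, OpenPartialHomeomorph.univBall_apply_zero]
  rw [← himage]
  exact (isConnected_compl_singleton_of_one_lt_rank h 0).image _
    (OpenPartialHomeomorph.continuous_univBall p r).continuousOn

/-- In dimension at least two, an isolated zero of a continuous function is a local extremum. -/
theorem isLocalExtr_of_isolated_zero {E : Type*} [NormedAddCommGroup E] [NormedSpace ℝ E]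
    (h : 1 < Module.rank ℝ E) {F : E → ℝ} (hF : Continuous F) {p : E} (hp : F p = 0)
    (hiso : ∀ᶠ x in nhdsWithin p {p}ᶜ, F x ≠ 0) : IsLocalExtr F p := by
  obtain ⟨r, hr, hball⟩ := Metric.mem_nhdsWithin_iff.mp hiso
  have hconn := (isConnected_ball_diff_center h p hr).isPreconnected
  have hne : ∀ x ∈ Metric.ball p r \ {p}, F x ≠ 0 := fun x hx => hball hx
  have hsign : (∀ x ∈ Metric.ball p r, 0 ≤ F x) ∨ ∀ x ∈ Metric.ball p r, F x ≤ 0 := by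
    by_contra! hcon
    obtain ⟨⟨a, ha, hFa⟩, ⟨b, hb, hFb⟩⟩ := hcon
    have hap : a ≠ p := by rintro rfl; exact hFa.ne hp
    have hbp : b ≠ p := by rintro rfl; exact hFb.ne' hp
    obtain ⟨c, hc, hFc⟩ := hconn.intermediate_value (a := a) (b := b) ⟨ha, hap⟩ ⟨hb, hbp⟩
      hF.continuousOn ⟨hFa.le, hFb.le⟩
    exact hne c hc hFc
  refine hsign.imp (fun hs => ?_) (fun hs => ?_) <;>
  · filter_upwards [Metric.ball_mem_nhds p hr] with x hx
    simpa [hp] using hs x hx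

namespace MvPolynomial

/-- An isolated real zero of a polynomial in at least two variables is a critical point. -/
theorem eval_pderiv_eq_zero_of_isolated_zero {σ : Type*} [Fintype σ] [Nontrivial σ]
    (g : MvPolynomial σ ℝ) {p : σ → ℝ} (hp : eval p g = 0)
    (hiso : ∀ᶠ x in nhdsWithin p {p}ᶜ, eval x g ≠ 0) (i : σ) : eval p (pderiv i g) = 0 := by
  classical
  have hrank : 1 < Module.rank ℝ (σ → ℝ) := by
    rw [rank_fun']
    exact_mod_cast Fintype.one_lt_card
  have hext : IsLocalExtr (fun x => eval x g) p :=
    isLocalExtr_of_isolated_zero hrank (continuous_eval g) hp hiso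
  have hcont : ContinuousAt (fun t => Function.update p i t) (p i) :=
    (continuous_const.update i continuous_id).continuousAt
  have hline : IsLocalExtr (fun t => eval (Function.update p i t) g) (p i) := by
    have ht : Filter.Tendsto (fun t => Function.update p i t) (nhds (p i)) (nhds p) := by
      simpa using hcont.tendsto
    refine hext.imp (fun h => ?_) (fun h => ?_)
    · filter_upwards [ht.eventually h] with t h'
      simpa using h'
    · filter_upwards [ht.eventually h] with t h'
      simpa using h'
  exact hline.hasDerivAt_eq_zero (hasDerivAt_eval_update g p i)

theorem ncard_zeros_le_sq_of_irreducible {g : MvPolynomial (Fin 2) ℝ} (hg : Irreducible g)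
    {U : Set (Fin 2 → ℝ)} (hU : IsOpen U) (hfin : {p | p ∈ U ∧ eval p g = 0}.Finite) :
    {p | p ∈ U ∧ eval p g = 0}.ncard ≤ g.totalDegree ^ 2 := by
  have hdeg : g.totalDegree ≠ 0 := fun h => by
    rw [totalDegree_eq_zero_iff_eq_C] at h
    have h0 : g.coeff 0 ≠ 0 := fun h' => hg.ne_zero (by rw [h, h', C_0])
    exact hg.not_isUnit (h ▸ (isUnit_iff_ne_zero.mpr h0).map C)
  obtain ⟨i, hi⟩ := exists_pderiv_ne_zero hdeg
  have hle := totalDegree_pderiv_le i g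
  have hrel : IsRelPrime g (pderiv i g) := by
    rw [hg.isRelPrime_iff_not_dvd]
    intro hdvd
    have := totalDegree_le_of_dvd_of_isDomain hdvd hi
    omega
  have hiso : ∀ p ∈ hfin.toFinset, ∀ᶠ x in nhdsWithin p {p}ᶜ, eval x g ≠ 0 := by
    intro p hp
    rw [Set.Finite.mem_toFinset] at hp
    have hclosed : IsClosed ({q | q ∈ U ∧ eval q g = 0} \ {p}) := hfin.sdiff.isClosed
    filter_upwards [self_mem_nhdsWithin, nhdsWithin_le_nhds (hU.mem_nhds hp.1),
      nhdsWithin_le_nhds (hclosed.isOpen_compl.mem_nhds (x := p) (by simp))] with x hxp hxU hx h0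
    exact hx ⟨⟨hxU, h0⟩, hxp⟩
  have hzero : ∀ p ∈ hfin.toFinset, eval p g = 0 := fun p hp => (hfin.mem_toFinset.mp hp).2
  rw [Set.ncard_eq_toFinset_card _ hfin]
  refine (card_common_zeros_le hg.ne_zero hrel hfin.toFinset hzero fun p hp =>
    eval_pderiv_eq_zero_of_isolated_zero g (hzero p hp) (hiso p hp) i).trans ?_
  rw [sq]
  exact Nat.mul_le_mul_left _ (hle.trans (Nat.sub_le _ _))

theorem ncard_zeros_le_sq {U : Set (Fin 2 → ℝ)} (hU : IsOpen U) (g : MvPolynomial (Fin 2) ℝ)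
    (hg : g ≠ 0) (hfin : {p | p ∈ U ∧ eval p g = 0}.Finite) :
    {p | p ∈ U ∧ eval p g = 0}.ncard ≤ g.totalDegree ^ 2 := by
  induction g using UniqueFactorizationMonoid.induction_on_prime with
  | h₁ => exact absurd rfl hg
  | h₂ g hu =>
    have : {p | p ∈ U ∧ eval p g = 0} = ∅ := by
      ext p
      simpa using fun _ => (hu.map (eval p)).ne_zero
    simp [this]
  | h₃ a q ha hq ih =>
    have hunion : {p | p ∈ U ∧ eval p (q * a) = 0} =
        {p | p ∈ U ∧ eval p q = 0} ∪ {p | p ∈ U ∧ eval p a = 0} := by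
      ext p
      simp [and_or_left]
    rw [hunion] at hfin ⊢
    rw [totalDegree_mul_of_isDomain hq.ne_zero ha]
    have h₁ := ncard_zeros_le_sq_of_irreducible hq.irreducible hU
      (hfin.subset Set.subset_union_left)
    have h₂ := ih ha (hfin.subset Set.subset_union_right)
    refine (Set.ncard_union_le _ _).trans ((add_le_add h₁ h₂).trans ?_)
    nlinarith [Nat.zero_le (q.totalDegree * a.totalDegree)]

end MvPolynomial

/-- **Lemma 8, degenerate case.** Let `g ∈ ℝ[X,Y]` be nonzero of total degree `d` and
`𝒰 ⊆ ℝ²` be open.  Then the zero set of `g` in `𝒰` is infinite or has at most `d²`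
elements. -/
theorem zero_set_infinite_or_card_le_sq
    (g : MvPolynomial (Fin 2) ℝ) (hg : g ≠ 0) (d : ℕ) (hd : g.totalDegree = d)
    (U : Set (ℝ × ℝ)) (hU : IsOpen U) :
    {p : ℝ × ℝ | p ∈ U ∧ eval ![p.1, p.2] g = 0}.Infinite ∨
      {p : ℝ × ℝ | p ∈ U ∧ eval ![p.1, p.2] g = 0}.ncard ≤ d ^ 2 := by
  subst hd
  refine or_iff_not_imp_left.mpr fun hfin => ?_
  rw [Set.not_infinite] at hfin
  let e : ℝ × ℝ ≃ₜ (Fin 2 → ℝ) := Homeomorph.finTwoArrow.symm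
  have himage : e '' {p : ℝ × ℝ | p ∈ U ∧ eval ![p.1, p.2] g = 0} =
      {p | p ∈ e.symm ⁻¹' U ∧ eval p g = 0} := by
    rw [← e.preimage_symm]
    ext p
    have hp : ![p 0, p 1] = p := by
      ext i
      fin_cases i <;> rfl
    simp [e, hp]
  rw [← Set.ncard_image_of_injective _ e.injective, himage]
  exact ncard_zeros_le_sq (hU.preimage e.symm.continuous) g hg (himage ▸ hfin.image e)
end
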